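/- arXiv:2411.12326 — 3 statements merged into one kernel-verified Lean document; each statement's English description precedes it below -/
import Mathlib

section
/- Let A ∈ [0,A_max]. Define G^l(p) = sup_{y ∈ [0,R^l]} (−p y + min{H^l(y), A_max}), G^r(p) = sup_{y ∈ [0,R^r]} (−p y + min{H^r(y), A_max}), and for t > 0 set w(t,x) = −t G^l(x/t) for x ≤ 0 and w(t,x) = −t G^r(x/t) for x ≥ 0. Define u : [0,∞) × ℝ → ℝ by u(0,x) = φ̂_0(x) and, for t > 0: u(t,x) = φ̂_A(x) − tA if x ∈ [t (H^l)'(p_A^{l,+}), t (H^r)'(p_A^{r,-})], and u(t,x) = w(t,x) otherwise. Then u is continuous on [0,∞) × ℝ, u(t,0) = −tA for every t ≥ 0, and u is a flux-limited viscosity solution with flux limiter A and initial datum φ̂_0. -/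
open Set Filter MeasureTheory Topology

noncomputable section

/-- The class `Lip`: Lipschitz functions with `u' ∈ [0,Rl]` a.e. on `(-∞,0)` and
`u' ∈ [0,Rr]` a.e. on `(0,∞)`, expressed through difference quotients. -/
def LipClass (Rl Rr : ℝ) (u : ℝ → ℝ) : Prop :=
  (∀ x y : ℝ, x ≤ y → y ≤ 0 → 0 ≤ u y - u x ∧ u y - u x ≤ Rl * (y - x)) ∧
  (∀ x y : ℝ, 0 ≤ x → x ≤ y → 0 ≤ u y - u x ∧ u y - u x ≤ Rr * (y - x))

/-- The discontinuous Hamiltonian `H(x,p)`. -/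
def Hx (Hl Hr : ℝ → ℝ) (x p : ℝ) : ℝ := if x < 0 then Hl p else Hr p

/-- `A_max = min{max_{[0,Rl]} Hl, max_{[0,Rr]} Hr}`. -/
def Amax (Hl Hr : ℝ → ℝ) (Rl Rr : ℝ) : ℝ :=
  min (sSup (Hl '' Icc 0 Rl)) (sSup (Hr '' Icc 0 Rr))

/-- `(H^l)^+(p) = sup_{0 ≤ y ≤ p} H^l(y)`. -/
def Hplus (Hl : ℝ → ℝ) (p : ℝ) : ℝ := sSup (Hl '' Icc 0 p)

/-- `(H^r)^-(p) = sup_{p ≤ y ≤ Rr} H^r(y)`. -/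
def Hminus (Hr : ℝ → ℝ) (Rr p : ℝ) : ℝ := sSup (Hr '' Icc p Rr)

/-- `p_A^{·,-}`: the smallest solution in `[0,R]` of `Hf p = A`. -/
def pm (Hf : ℝ → ℝ) (R A : ℝ) : ℝ := sInf {p ∈ Icc 0 R | Hf p = A}

/-- `p_A^{·,+}`: the largest solution in `[0,R]` of `Hf p = A`. -/
def pp (Hf : ℝ → ℝ) (R A : ℝ) : ℝ := sSup {p ∈ Icc 0 R | Hf p = A}

/-- `φ̂_A`. -/
def phiHat (Hl Hr : ℝ → ℝ) (Rl Rr A x : ℝ) : ℝ :=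
  if x ≤ 0 then pp Hl Rl A * x else pm Hr Rr A * x

/-- `φ̌_A`. -/
def phiCheck (Hl Hr : ℝ → ℝ) (Rl Rr A x : ℝ) : ℝ :=
  if x ≤ 0 then pm Hl Rl A * x else pp Hr Rr A * x

/-- A junction test function, given by a pair (φl, φr) of C¹ functions agreeing at `x = 0`. -/
def JTF (φl φr : ℝ → ℝ → ℝ) : Prop :=
  ContDiff ℝ 1 (fun p : ℝ × ℝ => φl p.1 p.2) ∧
  ContDiff ℝ 1 (fun p : ℝ × ℝ => φr p.1 p.2) ∧
  ∀ t, φl t 0 = φr t 0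

/-- The glued junction test function. -/
def glue (φl φr : ℝ → ℝ → ℝ) (t x : ℝ) : ℝ := if x ≤ 0 then φl t x else φr t x

/-- The time-space domain `[0,∞) × ℝ`. -/
def domHJ : Set (ℝ × ℝ) := Ici (0 : ℝ) ×ˢ (univ : Set ℝ)

/-- Flux-limited viscosity solution with flux limiter `A` and initial datum `u0`. -/
def FLSol (Hl Hr : ℝ → ℝ) (Rl Rr A : ℝ) (u0 : ℝ → ℝ) (u : ℝ → ℝ → ℝ) : Prop :=
  ContinuousOn (fun p : ℝ × ℝ => u p.1 p.2) domHJ ∧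
  (∀ t : ℝ, 0 ≤ t → LipClass Rl Rr (u t)) ∧
  (∀ x, u 0 x = u0 x) ∧
  (∀ φl φr : ℝ → ℝ → ℝ, JTF φl φr →
    ∀ t x : ℝ, 0 < t →
      IsLocalMaxOn (fun p : ℝ × ℝ => u p.1 p.2 - glue φl φr p.1 p.2) domHJ (t, x) →
      (x < 0 → deriv (fun s => φl s x) t + Hl (deriv (φl t) x) ≤ 0) ∧
      (0 < x → deriv (fun s => φr s x) t + Hr (deriv (φr t) x) ≤ 0) ∧
      (x = 0 → deriv (fun s => φl s 0) t +
        min A (min (Hplus Hl (deriv (φl t) 0)) (Hminus Hr Rr (deriv (φr t) 0))) ≤ 0)) ∧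
  (∀ φl φr : ℝ → ℝ → ℝ, JTF φl φr →
    ∀ t x : ℝ, 0 < t →
      IsLocalMinOn (fun p : ℝ × ℝ => u p.1 p.2 - glue φl φr p.1 p.2) domHJ (t, x) →
      (x < 0 → 0 ≤ deriv (fun s => φl s x) t + Hl (deriv (φl t) x)) ∧
      (0 < x → 0 ≤ deriv (fun s => φr s x) t + Hr (deriv (φr t) x)) ∧
      (x = 0 → 0 ≤ deriv (fun s => φl s 0) t +
        min A (min (Hplus Hl (deriv (φl t) 0)) (Hminus Hr Rr (deriv (φr t) 0)))))

/-- Viscosity solution of `∂_t u + H(x, ∂_x u) = 0` on `(0,∞) × (ℝ \ {0})`. -/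
def ViscSolOff (Hl Hr : ℝ → ℝ) (u : ℝ → ℝ → ℝ) : Prop :=
  ∀ φ : ℝ → ℝ → ℝ, ContDiff ℝ 1 (fun p : ℝ × ℝ => φ p.1 p.2) →
    ∀ t x : ℝ, 0 < t → x ≠ 0 →
      (IsLocalMaxOn (fun p : ℝ × ℝ => u p.1 p.2 - φ p.1 p.2) domHJ (t, x) →
        deriv (fun s => φ s x) t + Hx Hl Hr x (deriv (φ t) x) ≤ 0) ∧
      (IsLocalMinOn (fun p : ℝ × ℝ => u p.1 p.2 - φ p.1 p.2) domHJ (t, x) →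
        0 ≤ deriv (fun s => φ s x) t + Hx Hl Hr x (deriv (φ t) x))

/-- `G^{l/r}(p) = sup_{y ∈ [0,R]} (−p y + min{H(y), A_max})`. -/
def GA (Hf : ℝ → ℝ) (R A p : ℝ) : ℝ := sSup ((fun y => -(p * y) + min (Hf y) A) '' Icc 0 R)

/-- The function `w`, equal to `φ̂_0` at `t = 0` and to `−t G^{l/r}(x/t)` for `t > 0`. -/
def wfun (Hl Hr : ℝ → ℝ) (Rl Rr : ℝ) (t x : ℝ) : ℝ :=
  if t ≤ 0 then phiHat Hl Hr Rl Rr 0 x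
  else if x ≤ 0 then -t * GA Hl Rl (Amax Hl Hr Rl Rr) (x / t)
  else -t * GA Hr Rr (Amax Hl Hr Rl Rr) (x / t)

/-- The function `u` of Statement 7: `φ̂_0` at `t = 0`, `φ̂_A(x) − tA` on the cone
`x ∈ [t (H^l)'(p_A^{l,+}), t (H^r)'(p_A^{r,-})]` for `t > 0`, and `w` otherwise. -/
def ufun (Hl Hr : ℝ → ℝ) (Rl Rr A : ℝ) (t x : ℝ) : ℝ :=
  if t ≤ 0 then phiHat Hl Hr Rl Rr 0 x
  else if t * deriv Hl (pp Hl Rl A) ≤ x ∧ x ≤ t * deriv Hr (pm Hr Rr A)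
    then phiHat Hl Hr Rl Rr A x - t * A
    else wfun Hl Hr Rl Rr t x

/-- The lower envelope over `y ∈ [a,b]` of the linear functions `(t,x) ↦ x y - t H(y)`. -/
def linEnvelope (H : ℝ → ℝ) (a b t x : ℝ) : ℝ :=
  sInf ((fun y => x * y - t * H y) '' Icc a b)

section OneSidedDerivatives

variable {f : ℝ → ℝ} {a d x : ℝ}

theorem le_hasDerivAt_of_eventually_right (hf : HasDerivAt f d x)
    (h : ∀ᶠ y in 𝓝[>] x, f x + a * (y - x) ≤ f y) : a ≤ d := by
  have hs : Tendsto (slope f x) (𝓝[>] x) (𝓝 d) :=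
    hf.tendsto_slope.mono_left (nhdsWithin_mono _ fun y hy => ne_of_gt hy)
  refine ge_of_tendsto hs ?_
  filter_upwards [h, self_mem_nhdsWithin] with y hy hxy
  have hpos : 0 < y - x := sub_pos.2 hxy
  rw [slope_def_field, le_div_iff₀ hpos]
  linarith

theorem le_hasDerivAt_of_eventually_left (hf : HasDerivAt f d x)
    (h : ∀ᶠ y in 𝓝[<] x, f y ≤ f x + a * (y - x)) : a ≤ d := by
  have hs : Tendsto (slope f x) (𝓝[<] x) (𝓝 d) :=
    hf.tendsto_slope.mono_left (nhdsWithin_mono _ fun y hy => ne_of_lt hy)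
  refine ge_of_tendsto hs ?_
  filter_upwards [h, self_mem_nhdsWithin] with y hy hxy
  have hneg : y - x < 0 := sub_neg.2 hxy
  rw [slope_def_field, le_div_iff_of_neg hneg]
  linarith

theorem hasDerivAt_le_of_eventually_right (hf : HasDerivAt f d x)
    (h : ∀ᶠ y in 𝓝[>] x, f y ≤ f x + a * (y - x)) : d ≤ a := by
  have := le_hasDerivAt_of_eventually_right (a := -a) hf.neg (by
    filter_upwards [h] with y hy
    simp only [Pi.neg_apply]
    linarith)
  linarith

theorem hasDerivAt_le_of_eventually_left (hf : HasDerivAt f d x)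
    (h : ∀ᶠ y in 𝓝[<] x, f x + a * (y - x) ≤ f y) : d ≤ a := by
  have := le_hasDerivAt_of_eventually_left (a := -a) hf.neg (by
    filter_upwards [h] with y hy
    simp only [Pi.neg_apply]
    linarith)
  linarith

end OneSidedDerivatives

section PartialDerivatives

variable {φ : ℝ → ℝ → ℝ}

theorem hasDerivAt_fst_of_contDiff (hφ : ContDiff ℝ 1 fun p : ℝ × ℝ => φ p.1 p.2) (t x : ℝ) :
    HasDerivAt (fun s => φ s x) (deriv (fun s => φ s x) t) t := by
  have h : ContDiff ℝ 1 fun s => φ s x := hφ.comp (contDiff_id.prodMk contDiff_const)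
  exact (h.differentiable one_ne_zero t).hasDerivAt

theorem hasDerivAt_snd_of_contDiff (hφ : ContDiff ℝ 1 fun p : ℝ × ℝ => φ p.1 p.2) (t x : ℝ) :
    HasDerivAt (φ t) (deriv (φ t) x) x := by
  have h : ContDiff ℝ 1 (φ t) := hφ.comp (contDiff_const.prodMk contDiff_id)
  exact (h.differentiable one_ne_zero x).hasDerivAt

/-- The radial derivative of a `C¹` function in terms of its partial derivatives. -/
theorem hasDerivAt_radial_of_contDiff (hφ : ContDiff ℝ 1 fun p : ℝ × ℝ => φ p.1 p.2) (t x : ℝ) :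
    HasDerivAt (fun s : ℝ => φ (s * t) (s * x))
      (t * deriv (fun s => φ s x) t + x * deriv (φ t) x) 1 := by
  obtain ⟨L, hL⟩ := hφ.differentiable one_ne_zero (t, x)
  have ht : HasDerivAt (fun s => φ s x) (L (1, 0)) t :=
    hL.comp_hasDerivAt (f := fun s : ℝ => (s, x)) t
      ((hasDerivAt_id t).prodMk (hasDerivAt_const t x))
  have hx : HasDerivAt (φ t) (L (0, 1)) x :=
    hL.comp_hasDerivAt (f := fun s : ℝ => (t, s)) x
      ((hasDerivAt_const x t).prodMk (hasDerivAt_id x))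
  rw [ht.deriv, hx.deriv]
  have hr : HasDerivAt (fun s : ℝ => (s * t, s * x)) (t, x) 1 := by
    simpa using ((hasDerivAt_id (1 : ℝ)).mul_const t).prodMk ((hasDerivAt_id (1 : ℝ)).mul_const x)
  have hL' : HasFDerivAt (fun p : ℝ × ℝ => φ p.1 p.2) L ((1 : ℝ) * t, (1 : ℝ) * x) := by
    simpa using hL
  have hmain := hL'.comp_hasDerivAt (f := fun s : ℝ => (s * t, s * x)) 1 hr
  have hsplit : L (t, x) = t * L (1, 0) + x * L (0, 1) := by
    have : ((t, x) : ℝ × ℝ) = t • (1, 0) + x • (0, 1) := by simp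
    rw [this, map_add, map_smul, map_smul, smul_eq_mul, smul_eq_mul]
  rw [← hsplit]
  exact hmain

end PartialDerivatives

section Envelope

variable {H : ℝ → ℝ} {a b : ℝ}

theorem linEnvelope_le (hH : Continuous H) (t x : ℝ) {y : ℝ} (hy : y ∈ Icc a b) :
    linEnvelope H a b t x ≤ x * y - t * H y :=
  csInf_le (isCompact_Icc.image (by fun_prop)).bddBelow ⟨y, hy, rfl⟩

theorem exists_linEnvelope_eq (hH : Continuous H) (hab : a ≤ b) (t x : ℝ) :
    ∃ y ∈ Icc a b, linEnvelope H a b t x = x * y - t * H y :=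
  isCompact_Icc.exists_sInf_image_eq (nonempty_Icc.2 hab)
    (f := fun y => x * y - t * H y) (by fun_prop)

/-- A minimum characterisation of the envelope. -/
theorem linEnvelope_eq_of_isLeast {t x z : ℝ} (hz : z ∈ Icc a b)
    (h : ∀ y ∈ Icc a b, x * z - t * H z ≤ x * y - t * H y) :
    linEnvelope H a b t x = x * z - t * H z := by
  refine IsLeast.csInf_eq ⟨⟨z, hz, rfl⟩, ?_⟩
  rintro _ ⟨y, hy, rfl⟩
  exact h y hy

theorem continuous_linEnvelope (hH : Continuous H) :
    Continuous fun p : ℝ × ℝ => linEnvelope H a b p.1 p.2 := by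
  refine isCompact_Icc.continuous_sInf (f := fun (p : ℝ × ℝ) y => p.2 * y - p.1 * H y) ?_
  change Continuous fun q : (ℝ × ℝ) × ℝ => q.1.2 * q.2 - q.1.1 * H q.2
  fun_prop

theorem linEnvelope_smul (hH : Continuous H) (hab : a ≤ b) {s : ℝ} (hs : 0 ≤ s) (t x : ℝ) :
    linEnvelope H a b (s * t) (s * x) = s * linEnvelope H a b t x := by
  obtain ⟨z, hz, hzeq⟩ := exists_linEnvelope_eq hH hab t x
  rw [linEnvelope_eq_of_isLeast hz, hzeq]
  · ring
  · intro y hy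
    have := mul_le_mul_of_nonneg_left (hzeq ▸ linEnvelope_le hH t x hy) hs
    linarith

theorem le_linEnvelope_sub (hH : Continuous H) (hab : a ≤ b) (t : ℝ) {x x' : ℝ} (hx : x ≤ x') :
    a * (x' - x) ≤ linEnvelope H a b t x' - linEnvelope H a b t x := by
  obtain ⟨z, hz, hzeq⟩ := exists_linEnvelope_eq hH hab t x'
  have := linEnvelope_le hH t x hz
  nlinarith [mul_nonneg (sub_nonneg.2 hx) (sub_nonneg.2 hz.1)]

theorem linEnvelope_sub_le (hH : Continuous H) (hab : a ≤ b) (t : ℝ) {x x' : ℝ} (hx : x ≤ x') :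
    linEnvelope H a b t x' - linEnvelope H a b t x ≤ b * (x' - x) := by
  obtain ⟨z, hz, hzeq⟩ := exists_linEnvelope_eq hH hab t x
  have := linEnvelope_le hH t x' hz
  nlinarith [mul_nonneg (sub_nonneg.2 hx) (sub_nonneg.2 hz.2)]

variable {φ : ℝ → ℝ → ℝ} {t x : ℝ}

/-- The envelope is a viscosity subsolution. By homogeneity its radial derivative exists, which
identifies `t ∂_tφ + x ∂_xφ`, while the slope bounds force `∂_xφ ∈ [a,b]`. -/
theorem linEnvelope_subsolution (hH : Continuous H) (hab : a ≤ b)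
    (hφ : ContDiff ℝ 1 fun p : ℝ × ℝ => φ p.1 p.2) (ht : 0 < t)
    (hmax : IsLocalMax (fun p : ℝ × ℝ => linEnvelope H a b p.1 p.2 - φ p.1 p.2) (t, x)) :
    deriv (fun s => φ s x) t + H (deriv (φ t) x) ≤ 0 := by
  have hradial : linEnvelope H a b t x = t * deriv (fun s => φ s x) t + x * deriv (φ t) x := by
    have hcont : Tendsto (fun s : ℝ => (s * t, s * x)) (𝓝 1) (𝓝 (t, x)) := by
      have : Continuous fun s : ℝ => (s * t, s * x) := by fun_prop
      simpa using this.tendsto 1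
    have hloc : IsLocalMax (fun s : ℝ => s * linEnvelope H a b t x - φ (s * t) (s * x)) 1 := by
      filter_upwards [hcont.eventually hmax, lt_mem_nhds zero_lt_one] with s hs hs0
      simpa only [linEnvelope_smul hH hab hs0.le, one_mul] using hs
    have hd := ((hasDerivAt_id (1 : ℝ)).mul_const (linEnvelope H a b t x)).sub
      (hasDerivAt_radial_of_contDiff hφ t x)
    have := hloc.hasDerivAt_eq_zero hd
    linarith
  have hline : Tendsto (fun y : ℝ => (t, y)) (𝓝 x) (𝓝 (t, x)) :=
    (Continuous.prodMk_right t).tendsto x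
  have hslice := hline.eventually hmax
  have hpx := hasDerivAt_snd_of_contDiff hφ t x
  have hmem : deriv (φ t) x ∈ Icc a b := by
    constructor
    · refine le_hasDerivAt_of_eventually_right hpx ?_
      filter_upwards [nhdsWithin_le_nhds hslice, self_mem_nhdsWithin] with y hy hxy
      have := le_linEnvelope_sub hH hab t (le_of_lt hxy)
      linarith
    · refine hasDerivAt_le_of_eventually_left hpx ?_
      filter_upwards [nhdsWithin_le_nhds hslice, self_mem_nhdsWithin] with y hy hxy
      have := linEnvelope_sub_le hH hab t (le_of_lt hxy)
      linarith
  have := linEnvelope_le hH t x hmem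
  nlinarith

/-- The envelope is a viscosity supersolution, being touched from above by one of the linear
solutions that define it. -/
theorem linEnvelope_supersolution (hH : Continuous H) (hab : a ≤ b)
    (hφ : ContDiff ℝ 1 fun p : ℝ × ℝ => φ p.1 p.2)
    (hmin : IsLocalMin (fun p : ℝ × ℝ => linEnvelope H a b p.1 p.2 - φ p.1 p.2) (t, x)) :
    0 ≤ deriv (fun s => φ s x) t + H (deriv (φ t) x) := by
  obtain ⟨z, hz, hzeq⟩ := exists_linEnvelope_eq hH hab t x
  have hlin : IsLocalMin (fun p : ℝ × ℝ => p.2 * z - p.1 * H z - φ p.1 p.2) (t, x) := by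
    filter_upwards [hmin] with p hp
    have := linEnvelope_le hH p.1 p.2 hz
    linarith
  have hloct : IsLocalMin (fun s : ℝ => x * z - s * H z - φ s x) t :=
    ((Continuous.prodMk_left x).tendsto t).eventually hlin
  have hlocx : IsLocalMin (fun y : ℝ => y * z - t * H z - φ t y) x :=
    ((Continuous.prodMk_right t).tendsto x).eventually hlin
  have hdt := hloct.hasDerivAt_eq_zero
    ((((hasDerivAt_id t).mul_const (H z)).const_sub (x * z)).sub
      (hasDerivAt_fst_of_contDiff hφ t x))
  have hdx := hlocx.hasDerivAt_eq_zero
    ((((hasDerivAt_id x).mul_const z).sub_const (t * H z)).sub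
      (hasDerivAt_snd_of_contDiff hφ t x))
  have hpz : deriv (φ t) x = z := by linarith
  rw [hpz]
  linarith

end Envelope

/-- A concave function lies below its tangent lines. -/
theorem ConcaveOn.le_tangent {f : ℝ → ℝ} {s : Set ℝ} (hf : ConcaveOn ℝ s f) {x y : ℝ}
    (hx : x ∈ s) (hy : y ∈ s) (hd : DifferentiableAt ℝ f x) :
    f y ≤ f x + deriv f x * (y - x) := by
  rcases lt_trichotomy x y with h | h | h
  · have := hf.slope_le_of_hasDerivAt hx hy h hd.hasDerivAt
    rw [slope_def_field, div_le_iff₀ (sub_pos.2 h)] at this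
    linarith
  · simp [h]
  · have := hf.le_slope_of_hasDerivAt hy hx h hd.hasDerivAt
    rw [slope_def_field, le_div_iff₀ (sub_pos.2 h)] at this
    linarith

section Roots

variable {H : ℝ → ℝ} {R A : ℝ}

theorem isCompact_levelSet (hH : Continuous H) : IsCompact {p ∈ Icc 0 R | H p = A} :=
  isCompact_Icc.inter_right (isClosed_eq hH continuous_const)

theorem nonempty_levelSet (hH : Continuous H) (hR : 0 < R) (hHR : H R = 0) (hA0 : 0 ≤ A)
    (hA : A ≤ sSup (H '' Icc 0 R)) : {p ∈ Icc 0 R | H p = A}.Nonempty := by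
  obtain ⟨m, hm, hmeq⟩ := isCompact_Icc.exists_sSup_image_eq (nonempty_Icc.2 hR.le)
    hH.continuousOn
  obtain ⟨p, hp, hpA⟩ := intermediate_value_Icc' hm.2 hH.continuousOn
    (show A ∈ Icc (H R) (H m) from ⟨hHR ▸ hA0, hmeq ▸ hA⟩)
  exact ⟨p, ⟨hm.1.trans hp.1, hp.2⟩, hpA⟩

theorem le_of_pp_le (hH : Continuous H) (hHR : H R = 0) (hA0 : 0 ≤ A)
    (hpp : pp H R A ∈ {p ∈ Icc 0 R | H p = A}) {y : ℝ} (hy : y ∈ Icc (pp H R A) R) :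
    H y ≤ A := by
  by_contra! hlt
  obtain ⟨p, hp, hpA⟩ := intermediate_value_Icc' hy.2 hH.continuousOn
    (show A ∈ Icc (H R) (H y) from ⟨hHR.le.trans hA0, hlt.le⟩)
  have hle : p ≤ pp H R A := le_csSup (isCompact_levelSet hH).bddAbove
    ⟨⟨(hpp.1.1.trans hy.1).trans hp.1, hp.2⟩, hpA⟩
  have : p = y := le_antisymm (hle.trans hy.1) hp.1
  rw [← this, hpA] at hlt
  exact lt_irrefl _ hlt

theorem le_of_le_pm (hH : Continuous H) (hH0 : H 0 = 0) (hA0 : 0 ≤ A)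
    (hpm : pm H R A ∈ {p ∈ Icc 0 R | H p = A}) {y : ℝ} (hy : y ∈ Icc 0 (pm H R A)) :
    H y ≤ A := by
  by_contra! hlt
  obtain ⟨p, hp, hpA⟩ := intermediate_value_Icc hy.1 hH.continuousOn
    (show A ∈ Icc (H 0) (H y) from ⟨hH0.le.trans hA0, hlt.le⟩)
  have hle : pm H R A ≤ p := csInf_le (isCompact_levelSet hH).bddBelow
    ⟨⟨hp.1, (hp.2.trans hy.2).trans hpm.1.2⟩, hpA⟩
  have : p = y := le_antisymm hp.2 (hy.2.trans hle)
  rw [← this, hpA] at hlt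
  exact lt_irrefl _ hlt

theorem nonneg_of_concaveOn (hc : ConcaveOn ℝ (Icc 0 R) H) (hH0 : H 0 = 0) (hHR : H R = 0)
    {y : ℝ} (hy : y ∈ Icc 0 R) : 0 ≤ H y := by
  have hR : 0 ≤ R := hy.1.trans hy.2
  simpa [hH0, hHR] using
    hc.min_le_of_mem_Icc (left_mem_Icc.2 hR) (right_mem_Icc.2 hR) hy

theorem deriv_pp_nonpos (hH : ContDiff ℝ 1 H) (hR : 0 < R) (hc : ConcaveOn ℝ (Icc 0 R) H)
    (hH0 : H 0 = 0) (hHR : H R = 0) (hA0 : 0 ≤ A)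
    (hpp : pp H R A ∈ {p ∈ Icc 0 R | H p = A}) : deriv H (pp H R A) ≤ 0 := by
  have hd := (hH.differentiable one_ne_zero (pp H R A)).hasDerivAt
  rcases hpp.1.2.lt_or_eq with hlt | heq
  · refine hasDerivAt_le_of_eventually_right hd ?_
    filter_upwards [Ioc_mem_nhdsGT hlt] with y hy
    have := le_of_pp_le hH.continuous hHR hA0 hpp ⟨hy.1.le, hy.2⟩
    rw [hpp.2]
    linarith
  · refine hasDerivAt_le_of_eventually_left hd ?_
    rw [heq]
    filter_upwards [Ico_mem_nhdsLT hR] with y hy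
    have := nonneg_of_concaveOn hc hH0 hHR ⟨hy.1, hy.2.le⟩
    rw [hHR]
    linarith

theorem deriv_pm_nonneg (hH : ContDiff ℝ 1 H) (hR : 0 < R) (hc : ConcaveOn ℝ (Icc 0 R) H)
    (hH0 : H 0 = 0) (hHR : H R = 0) (hA0 : 0 ≤ A)
    (hpm : pm H R A ∈ {p ∈ Icc 0 R | H p = A}) : 0 ≤ deriv H (pm H R A) := by
  have hd := (hH.differentiable one_ne_zero (pm H R A)).hasDerivAt
  rcases hpm.1.1.lt_or_eq with hlt | heq
  · refine le_hasDerivAt_of_eventually_left hd ?_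
    filter_upwards [Ico_mem_nhdsLT hlt] with y hy
    have := le_of_le_pm hH.continuous hH0 hA0 hpm ⟨hy.1, hy.2.le⟩
    rw [hpm.2]
    linarith
  · refine le_hasDerivAt_of_eventually_right hd ?_
    rw [← heq]
    filter_upwards [Ioc_mem_nhdsGT hR] with y hy
    have := nonneg_of_concaveOn hc hH0 hHR ⟨hy.1.le, hy.2⟩
    rw [hH0]
    linarith

theorem pp_zero (hH : Continuous H) (hR : 0 < R) (hHR : H R = 0) : pp H R 0 = R :=
  le_antisymm (csSup_le ⟨R, ⟨hR.le, le_rfl⟩, hHR⟩ fun _ hy => hy.1.2)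
    (le_csSup (isCompact_levelSet hH).bddAbove ⟨⟨hR.le, le_rfl⟩, hHR⟩)

theorem pm_zero (hH : Continuous H) (hR : 0 < R) (hH0 : H 0 = 0) : pm H R 0 = 0 :=
  le_antisymm (csInf_le (isCompact_levelSet hH).bddBelow ⟨⟨le_rfl, hR.le⟩, hH0⟩)
    (le_csInf ⟨0, ⟨le_rfl, hR.le⟩, hH0⟩ fun _ hy => hy.1.1)

end Roots

/-- If the envelope over `[a,b] ⊆ [0,R]` is not improved by the truncated Hamiltonian on `[0,R]`,
it is the Legendre-type transform `GA` up to scaling. -/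
theorem neg_mul_GA_eq_linEnvelope {H : ℝ → ℝ} {R M a b t x : ℝ} (hH : Continuous H)
    (hab : a ≤ b) (ha : 0 ≤ a) (hb : b ≤ R) (ht : 0 < t)
    (hM : ∀ y ∈ Icc a b, H y ≤ M)
    (hout : ∀ y ∈ Icc 0 R, linEnvelope H a b t x ≤ x * y - t * H y) :
    -t * GA H R M (x / t) = linEnvelope H a b t x := by
  obtain ⟨z, hz, hzeq⟩ := exists_linEnvelope_eq hH hab t x
  have hgreat : IsGreatest ((fun y => -(x / t * y) + min (H y) M) '' Icc 0 R)
      (-(x / t * z) + H z) := by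
    refine ⟨⟨z, ⟨ha.trans hz.1, hz.2.trans hb⟩, by simp [hM z hz]⟩, ?_⟩
    rintro _ ⟨y, hy, rfl⟩
    have h1 := hout y hy
    rw [hzeq] at h1
    have h2 : x / t * t = x := div_mul_cancel₀ x ht.ne'
    have h3 := min_le_left (H y) M
    have h4 : t * (-(x / t * y) + H y) ≤ t * (-(x / t * z) + H z) := by
      have e : ∀ w, t * (-(x / t * w) + H w) = -(x * w - t * H w) := fun w => by
        linear_combination (-w) * h2
      rw [e, e]
      linarith
    have h5 := le_of_mul_le_mul_left h4 ht
    simp only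
    linarith
  rw [GA, hgreat.csSup_eq, hzeq]
  field_simp
  ring

section Representation

variable {Hl Hr : ℝ → ℝ} {Rl Rr A : ℝ}

theorem ufun_eq_linEnvelope_left (hRl : 0 < Rl) (hRr : 0 < Rr)
    (hHl : ContDiff ℝ 1 Hl) (hHlc : ConcaveOn ℝ (Icc 0 Rl) Hl)
    (hHlR : Hl Rl = 0)
    (hHr : ContDiff ℝ 1 Hr) (hHrc : ConcaveOn ℝ (Icc 0 Rr) Hr)
    (hHr0 : Hr 0 = 0) (hHrR : Hr Rr = 0)
    (hA : A ∈ Icc (0 : ℝ) (Amax Hl Hr Rl Rr))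
    (hpp : pp Hl Rl A ∈ {p ∈ Icc 0 Rl | Hl p = A})
    (hpm : pm Hr Rr A ∈ {p ∈ Icc 0 Rr | Hr p = A})
    {t x : ℝ} (ht : 0 ≤ t) (hx : x ≤ 0) :
    ufun Hl Hr Rl Rr A t x = linEnvelope Hl (pp Hl Rl A) Rl t x := by
  have hcont := hHl.continuous
  have hmem : pp Hl Rl A ∈ Icc (pp Hl Rl A) Rl := ⟨le_rfl, hpp.1.2⟩
  rcases ht.eq_or_lt with rfl | ht
  · rw [linEnvelope_eq_of_isLeast (z := Rl) ⟨hpp.1.2, le_rfl⟩]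
    · simp [ufun, phiHat, hx, pp_zero hcont hRl hHlR, mul_comm]
    · intro y hy
      nlinarith [hy.2]
  · have htan : ∀ y ∈ Icc 0 Rl, x * pp Hl Rl A - t * Hl (pp Hl Rl A) +
        (x - t * deriv Hl (pp Hl Rl A)) * (y - pp Hl Rl A) ≤ x * y - t * Hl y := by
      intro y hy
      have := mul_le_mul_of_nonneg_left
        (hHlc.le_tangent hpp.1 hy (hHl.differentiable one_ne_zero _)) ht.le
      linarith
    have hr : x ≤ t * deriv Hr (pm Hr Rr A) :=
      hx.trans (mul_nonneg ht.le (deriv_pm_nonneg hHr hRr hHrc hHr0 hHrR hA.1 hpm))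
    by_cases hcone : t * deriv Hl (pp Hl Rl A) ≤ x
    · rw [linEnvelope_eq_of_isLeast hmem]
      · simp [ufun, phiHat, ht.not_ge, hcone, hr, hx, hpp.2, mul_comm]
      · intro y hy
        have := htan y ⟨hpp.1.1.trans hy.1, hy.2⟩
        have := mul_nonneg (sub_nonneg.2 hcone) (sub_nonneg.2 hy.1)
        linarith
    · have : ufun Hl Hr Rl Rr A t x = -t * GA Hl Rl (Amax Hl Hr Rl Rr) (x / t) := by
        simp [ufun, wfun, ht.not_ge, hcone, hx]
      rw [this]
      refine neg_mul_GA_eq_linEnvelope hcont hpp.1.2 hpp.1.1 le_rfl ht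
        (fun y hy => (le_of_pp_le hcont hHlR hA.1 hpp hy).trans hA.2) fun y hy => ?_
      rcases le_total (pp Hl Rl A) y with hle | hle
      · exact linEnvelope_le hcont t x ⟨hle, hy.2⟩
      · have h1 := linEnvelope_le hcont t x hmem
        have h2 := htan y hy
        have h3 := mul_nonneg_of_nonpos_of_nonpos (sub_nonpos.2 (not_le.1 hcone).le)
          (sub_nonpos.2 hle)
        linarith

theorem ufun_eq_linEnvelope_right (hRl : 0 < Rl) (hRr : 0 < Rr)
    (hHl : ContDiff ℝ 1 Hl) (hHlc : ConcaveOn ℝ (Icc 0 Rl) Hl)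
    (hHl0 : Hl 0 = 0) (hHlR : Hl Rl = 0)
    (hHr : ContDiff ℝ 1 Hr) (hHrc : ConcaveOn ℝ (Icc 0 Rr) Hr)
    (hHr0 : Hr 0 = 0)
    (hA : A ∈ Icc (0 : ℝ) (Amax Hl Hr Rl Rr))
    (hpp : pp Hl Rl A ∈ {p ∈ Icc 0 Rl | Hl p = A})
    (hpm : pm Hr Rr A ∈ {p ∈ Icc 0 Rr | Hr p = A})
    {t x : ℝ} (ht : 0 ≤ t) (hx : 0 < x) :
    ufun Hl Hr Rl Rr A t x = linEnvelope Hr 0 (pm Hr Rr A) t x := by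
  have hcont := hHr.continuous
  have hmem : pm Hr Rr A ∈ Icc 0 (pm Hr Rr A) := ⟨hpm.1.1, le_rfl⟩
  rcases ht.eq_or_lt with rfl | ht
  · rw [linEnvelope_eq_of_isLeast (z := 0) ⟨le_rfl, hpm.1.1⟩]
    · simp [ufun, phiHat, hx.not_ge, pm_zero hcont hRr hHr0]
    · intro y hy
      nlinarith [mul_nonneg hx.le hy.1]
  · have htan : ∀ y ∈ Icc 0 Rr, x * pm Hr Rr A - t * Hr (pm Hr Rr A) +
        (x - t * deriv Hr (pm Hr Rr A)) * (y - pm Hr Rr A) ≤ x * y - t * Hr y := by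
      intro y hy
      have := mul_le_mul_of_nonneg_left
        (hHrc.le_tangent hpm.1 hy (hHr.differentiable one_ne_zero _)) ht.le
      linarith
    have hl : t * deriv Hl (pp Hl Rl A) ≤ x :=
      (mul_nonpos_of_nonneg_of_nonpos ht.le
        (deriv_pp_nonpos hHl hRl hHlc hHl0 hHlR hA.1 hpp)).trans hx.le
    by_cases hcone : x ≤ t * deriv Hr (pm Hr Rr A)
    · rw [linEnvelope_eq_of_isLeast hmem]
      · simp [ufun, phiHat, ht.not_ge, hcone, hl, hx.not_ge, hpm.2, mul_comm]
      · intro y hy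
        have := htan y ⟨hy.1, hy.2.trans hpm.1.2⟩
        have := mul_nonneg_of_nonpos_of_nonpos (sub_nonpos.2 hcone) (sub_nonpos.2 hy.2)
        linarith
    · have : ufun Hl Hr Rl Rr A t x = -t * GA Hr Rr (Amax Hl Hr Rl Rr) (x / t) := by
        simp [ufun, wfun, ht.not_ge, hcone, hx.not_ge]
      rw [this]
      refine neg_mul_GA_eq_linEnvelope hcont hpm.1.1 le_rfl hpm.1.2 ht
        (fun y hy => (le_of_le_pm hcont hHr0 hA.1 hpm hy).trans hA.2) fun y hy => ?_
      rcases le_total y (pm Hr Rr A) with hle | hle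
      · exact linEnvelope_le hcont t x ⟨hy.1, hle⟩
      · have h1 := linEnvelope_le hcont t x hmem
        have h2 := htan y hy
        have h3 := mul_nonneg (sub_nonneg.2 (not_le.1 hcone).le) (sub_nonneg.2 hle)
        linarith

end Representation

/-- Two envelopes glued along `x = 0`, where both equal `-tA`, form a flux-limited viscosity
solution with flux limiter `A`. -/
theorem flSol_of_eq_linEnvelope {Hl Hr : ℝ → ℝ} {Rl Rr A a b : ℝ} {u0 : ℝ → ℝ}
    {u : ℝ → ℝ → ℝ} (hHl : Continuous Hl) (hHr : Continuous Hr)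
    (ha : a ∈ Icc 0 Rl) (hb : b ∈ Icc 0 Rr) (haA : Hl a = A) (hbA : Hr b = A)
    (hu0 : ∀ x, u 0 x = u0 x)
    (hul : ∀ t x, 0 ≤ t → x ≤ 0 → u t x = linEnvelope Hl a Rl t x)
    (hur : ∀ t x, 0 ≤ t → 0 ≤ x → u t x = linEnvelope Hr 0 b t x)
    (hut : ∀ t, 0 ≤ t → u t 0 = -t * A) :
    FLSol Hl Hr Rl Rr A u0 u := by
  have hdom : ∀ t x : ℝ, 0 < t → domHJ ∈ 𝓝 (t, x) := fun t x ht =>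
    prod_mem_nhds (Ici_mem_nhds ht) univ_mem
  have hleft : ∀ φl φr : ℝ → ℝ → ℝ, ∀ t x : ℝ, 0 < t → x < 0 →
      (fun p : ℝ × ℝ => u p.1 p.2 - glue φl φr p.1 p.2) =ᶠ[𝓝 (t, x)]
        fun p => linEnvelope Hl a Rl p.1 p.2 - φl p.1 p.2 := by
    intro φl φr t x ht hx
    filter_upwards [prod_mem_nhds (Ici_mem_nhds ht) (Iic_mem_nhds hx)] with p hp
    rw [hul p.1 p.2 hp.1 hp.2, glue, if_pos (show p.2 ≤ 0 from hp.2)]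
  have hright : ∀ φl φr : ℝ → ℝ → ℝ, ∀ t x : ℝ, 0 < t → 0 < x →
      (fun p : ℝ × ℝ => u p.1 p.2 - glue φl φr p.1 p.2) =ᶠ[𝓝 (t, x)]
        fun p => linEnvelope Hr 0 b p.1 p.2 - φr p.1 p.2 := by
    intro φl φr t x ht hx
    filter_upwards [prod_mem_nhds (Ici_mem_nhds ht) (Ioi_mem_nhds hx)] with p hp
    rw [hur p.1 p.2 hp.1 (le_of_lt hp.2), glue, if_neg (not_le.2 hp.2)]
  have haxis : ∀ φl φr : ℝ → ℝ → ℝ, JTF φl φr → ∀ t : ℝ, 0 < t →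
      IsLocalExtr (fun p : ℝ × ℝ => u p.1 p.2 - glue φl φr p.1 p.2) (t, 0) →
      deriv (fun s => φl s 0) t = -A := by
    intro φl φr hJ t ht hext
    have heq : (fun s : ℝ => u s 0 - glue φl φr s 0) =ᶠ[𝓝 t] fun s => -s * A - φl s 0 := by
      filter_upwards [Ici_mem_nhds ht] with s hs
      rw [hut s hs, glue, if_pos le_rfl]
    have hext' : IsLocalExtr (fun s : ℝ => u s 0 - glue φl φr s 0) t :=
      hext.comp_tendsto (g := fun s : ℝ => (s, (0 : ℝ)))
        ((Continuous.prodMk_left (0 : ℝ)).tendsto t)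
    have hext'' := heq.isLocalExtr_iff.1 hext'
    have := hext''.hasDerivAt_eq_zero
      (((hasDerivAt_id t).neg.mul_const A).sub (hasDerivAt_fst_of_contDiff hJ.1 t 0))
    linarith
  refine ⟨?_, ?_, hu0, ?_, ?_⟩
  · have hc : Continuous fun p : ℝ × ℝ => linEnvelope Hl a Rl p.1 (min p.2 0) +
        linEnvelope Hr 0 b p.1 (max p.2 0) + p.1 * A :=
      (((continuous_linEnvelope hHl).comp
          (continuous_fst.prodMk (continuous_snd.min continuous_const))).add
        ((continuous_linEnvelope hHr).comp
          (continuous_fst.prodMk (continuous_snd.max continuous_const)))).add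
        (continuous_fst.mul continuous_const)
    refine hc.continuousOn.congr fun p hp => ?_
    have hp1 : 0 ≤ p.1 := hp.1
    have h0 := hut p.1 hp1
    rcases le_total p.2 0 with hx | hx
    · simp only [min_eq_left hx, max_eq_right hx, ← hul p.1 p.2 hp1 hx, ← hur p.1 0 hp1 le_rfl]
      linarith
    · simp only [min_eq_right hx, max_eq_left hx, ← hur p.1 p.2 hp1 hx, ← hul p.1 0 hp1 le_rfl]
      linarith
  · refine fun t ht => ⟨fun x y hxy hy => ?_, fun x y hx hxy => ?_⟩
    · rw [hul t x ht (hxy.trans hy), hul t y ht hy]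
      exact ⟨(mul_nonneg ha.1 (sub_nonneg.2 hxy)).trans (le_linEnvelope_sub hHl ha.2 t hxy),
        linEnvelope_sub_le hHl ha.2 t hxy⟩
    · rw [hur t x ht hx, hur t y ht (hx.trans hxy)]
      exact ⟨by simpa using le_linEnvelope_sub hHr hb.1 t hxy,
        (linEnvelope_sub_le hHr hb.1 t hxy).trans
          (mul_le_mul_of_nonneg_right hb.2 (sub_nonneg.2 hxy))⟩
  · intro φl φr hJ t x ht hmax
    replace hmax : IsLocalMax _ (t, x) := hmax.isLocalMax (hdom t x ht)
    refine ⟨fun hx => ?_, fun hx => ?_, ?_⟩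
    · exact linEnvelope_subsolution hHl ha.2 hJ.1 ht ((hleft φl φr t x ht hx).isLocalMax_iff.1 hmax)
    · exact linEnvelope_subsolution hHr hb.1 hJ.2.1 ht
        ((hright φl φr t x ht hx).isLocalMax_iff.1 hmax)
    · rintro rfl
      rw [haxis φl φr hJ t ht (Or.inr hmax)]
      linarith [min_le_left A (min (Hplus Hl (deriv (φl t) 0)) (Hminus Hr Rr (deriv (φr t) 0)))]
  · intro φl φr hJ t x ht hmin
    replace hmin : IsLocalMin _ (t, x) := hmin.isLocalMin (hdom t x ht)
    refine ⟨fun hx => ?_, fun hx => ?_, ?_⟩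
    · exact linEnvelope_supersolution hHl ha.2 hJ.1 ((hleft φl φr t x ht hx).isLocalMin_iff.1 hmin)
    · exact linEnvelope_supersolution hHr hb.1 hJ.2.1
        ((hright φl φr t x ht hx).isLocalMin_iff.1 hmin)
    · rintro rfl
      have hslice := ((Continuous.prodMk_right t).tendsto (0 : ℝ)).eventually hmin
      have hpl : a ≤ deriv (φl t) 0 := by
        refine le_hasDerivAt_of_eventually_left (hasDerivAt_snd_of_contDiff hJ.1 t 0) ?_
        filter_upwards [nhdsWithin_le_nhds hslice, self_mem_nhdsWithin] with y hy hy0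
        have hy0' : y ≤ 0 := le_of_lt hy0
        simp only [glue, if_pos hy0', if_pos (le_refl (0 : ℝ)), hul t y ht.le hy0',
          hul t 0 ht.le le_rfl] at hy
        linarith [le_linEnvelope_sub hHl ha.2 t hy0']
      have hpr : deriv (φr t) 0 ≤ b := by
        refine hasDerivAt_le_of_eventually_right (hasDerivAt_snd_of_contDiff hJ.2.1 t 0) ?_
        filter_upwards [nhdsWithin_le_nhds hslice, self_mem_nhdsWithin] with y hy hy0
        have hy0' : 0 < y := hy0
        simp only [glue, if_neg hy0'.not_ge, if_pos (le_refl (0 : ℝ)), hur t y ht.le hy0'.le,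
          hur t 0 ht.le le_rfl, hJ.2.2 t] at hy
        linarith [linEnvelope_sub_le hHr hb.1 t hy0'.le]
      have hplus : A ≤ Hplus Hl (deriv (φl t) 0) :=
        le_csSup (isCompact_Icc.image hHl).bddAbove ⟨a, ⟨ha.1, hpl⟩, haA⟩
      have hminus : A ≤ Hminus Hr Rr (deriv (φr t) 0) :=
        le_csSup (isCompact_Icc.image hHr).bddAbove ⟨b, ⟨hpr, hb.2⟩, hbA⟩
      rw [haxis φl φr hJ t ht (Or.inl hmin), min_eq_left (le_min hplus hminus)]
      linarith

/-- `u` is continuous, satisfies `u(t,0) = −tA`, and is the flux-limited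
viscosity solution with flux limiter `A` and initial datum `φ̂_0`. -/
theorem u_cone_properties
    (Hl Hr : ℝ → ℝ) (Rl Rr : ℝ) (hRl : 0 < Rl) (hRr : 0 < Rr)
    (hHl : ContDiff ℝ 1 Hl) (hHlc : StrictConcaveOn ℝ (Icc 0 Rl) Hl)
    (hHl0 : Hl 0 = 0) (hHlR : Hl Rl = 0)
    (hHr : ContDiff ℝ 1 Hr) (hHrc : StrictConcaveOn ℝ (Icc 0 Rr) Hr)
    (hHr0 : Hr 0 = 0) (hHrR : Hr Rr = 0)
    (A : ℝ) (hA : A ∈ Icc (0 : ℝ) (Amax Hl Hr Rl Rr)) :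
    ContinuousOn (fun p : ℝ × ℝ => ufun Hl Hr Rl Rr A p.1 p.2) domHJ ∧
    (∀ t : ℝ, 0 ≤ t → ufun Hl Hr Rl Rr A t 0 = -t * A) ∧
    FLSol Hl Hr Rl Rr A (phiHat Hl Hr Rl Rr 0) (ufun Hl Hr Rl Rr A) := by
  have hcl := hHl.continuous
  have hcr := hHr.continuous
  have hpp : pp Hl Rl A ∈ {p ∈ Icc 0 Rl | Hl p = A} := (isCompact_levelSet hcl).sSup_mem
    (nonempty_levelSet hcl hRl hHlR hA.1 (hA.2.trans (min_le_left _ _)))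
  have hpm : pm Hr Rr A ∈ {p ∈ Icc 0 Rr | Hr p = A} := (isCompact_levelSet hcr).sInf_mem
    (nonempty_levelSet hcr hRr hHrR hA.1 (hA.2.trans (min_le_right _ _)))
  have hul : ∀ t x, 0 ≤ t → x ≤ 0 →
      ufun Hl Hr Rl Rr A t x = linEnvelope Hl (pp Hl Rl A) Rl t x := fun t x =>
    ufun_eq_linEnvelope_left hRl hRr hHl hHlc.concaveOn hHlR hHr hHrc.concaveOn hHr0 hHrR hA
      hpp hpm
  have hut : ∀ t : ℝ, 0 ≤ t → ufun Hl Hr Rl Rr A t 0 = -t * A := by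
    intro t ht
    rw [hul t 0 ht le_rfl, linEnvelope_eq_of_isLeast (z := pp Hl Rl A) ⟨le_rfl, hpp.1.2⟩, hpp.2]
    · ring
    · intro y hy
      have := mul_le_mul_of_nonneg_left (le_of_pp_le hcl hHlR hA.1 hpp hy) ht
      rw [hpp.2]
      linarith
  have hur : ∀ t x, 0 ≤ t → 0 ≤ x →
      ufun Hl Hr Rl Rr A t x = linEnvelope Hr 0 (pm Hr Rr A) t x := by
    intro t x ht hx
    rcases hx.eq_or_lt with rfl | hx
    · rw [hut t ht, linEnvelope_eq_of_isLeast (z := pm Hr Rr A) ⟨hpm.1.1, le_rfl⟩, hpm.2]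
      · ring
      · intro y hy
        have := mul_le_mul_of_nonneg_left (le_of_le_pm hcr hHr0 hA.1 hpm hy) ht
        rw [hpm.2]
        linarith
    · exact ufun_eq_linEnvelope_right hRl hRr hHl hHlc.concaveOn hHl0 hHlR hHr hHrc.concaveOn
        hHr0 hA hpp hpm ht hx
  have hsol : FLSol Hl Hr Rl Rr A (phiHat Hl Hr Rl Rr 0) (ufun Hl Hr Rl Rr A) :=
    flSol_of_eq_linEnvelope hcl hcr hpp.1 hpm.1 hpp.2 hpm.2 (fun x => by simp [ufun]) hul hur hut
  exact ⟨hsol.1, hut, hsol⟩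
end
end

section
/- Let 0 ≤ β < A ≤ A_max and define u(t,x) = max{φ̌_A(x) − At, φ̂_β(x) − βt} for (t,x) ∈ [0,∞) × ℝ. Then: u is continuous; u(0,·) = φ̌_A; u(t,0) = −βt for every t ≥ 0; for every t > 0 there exists η > 0 such that u(s,x) = φ̂_β(x) − βs whenever |s − t| ≤ η and |x| ≤ η; and u is a viscosity solution of ∂_t u + H(x,∂_x u) = 0 on (0,∞) × (ℝ∖{0}). -/
open Set Filter MeasureTheory Topology

noncomputable section

section LevelSets

variable {H : ℝ → ℝ} {R a q : ℝ}

theorem exists_level_of_le_sSup (hH : Continuous H) (hR : 0 < R) (h0 : H 0 = 0)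
    (ha : 0 ≤ a) (haS : a ≤ sSup (H '' Icc 0 R)) : ∃ p ∈ Icc 0 R, H p = a := by
  obtain ⟨m, hm, hmS⟩ := (isCompact_Icc.image hH).sSup_mem
    ((nonempty_Icc.2 hR.le).image H)
  obtain ⟨p, hp, hpa⟩ := intermediate_value_Icc hm.1 hH.continuousOn
    (show a ∈ Icc (H 0) (H m) from ⟨h0.le.trans ha, haS.trans hmS.ge⟩)
  exact ⟨p, ⟨hp.1, hp.2.trans hm.2⟩, hpa⟩

theorem isCompact_level (hH : Continuous H) : IsCompact {p ∈ Icc 0 R | H p = a} :=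
  isCompact_Icc.inter_right (isClosed_eq hH continuous_const)

theorem pm_mem_level (hH : Continuous H) (h : ∃ p ∈ Icc 0 R, H p = a) :
    pm H R a ∈ Icc 0 R ∧ H (pm H R a) = a :=
  (isCompact_level hH).sInf_mem h

theorem pp_mem_level (hH : Continuous H) (h : ∃ p ∈ Icc 0 R, H p = a) :
    pp H R a ∈ Icc 0 R ∧ H (pp H R a) = a :=
  (isCompact_level hH).sSup_mem h

theorem pm_le_of_le_level (hH : Continuous H) (h0 : H 0 = 0) (ha : 0 ≤ a)
    (hq : q ∈ Icc 0 R) (haq : a ≤ H q) : pm H R a ≤ q := by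
  obtain ⟨p, hp, hpa⟩ := intermediate_value_Icc hq.1 hH.continuousOn
    (show a ∈ Icc (H 0) (H q) from ⟨h0.le.trans ha, haq⟩)
  exact (csInf_le (isCompact_level hH).bddBelow ⟨⟨hp.1, hp.2.trans hq.2⟩, hpa⟩).trans hp.2

theorem le_pp_of_le_level (hH : Continuous H) (hR : H R = 0) (ha : 0 ≤ a)
    (hq : q ∈ Icc 0 R) (haq : a ≤ H q) : q ≤ pp H R a := by
  obtain ⟨p, hp, hpa⟩ := intermediate_value_Icc' hq.2 hH.continuousOn
    (show a ∈ Icc (H R) (H q) from ⟨hR.le.trans ha, haq⟩)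
  exact hp.1.trans (le_csSup (isCompact_level hH).bddAbove ⟨⟨hq.1.trans hp.1, hp.2⟩, hpa⟩)

end LevelSets

section TestFunctions

variable {φ : ℝ → ℝ → ℝ} {t x : ℝ}

theorem hasDerivAt_comp_line (hφ : DifferentiableAt ℝ (fun p : ℝ × ℝ => φ p.1 p.2) (t, x))
    (v w : ℝ) :
    HasDerivAt (fun r => φ (t + r * v) (x + r * w))
      (deriv (fun s => φ s x) t * v + deriv (φ t) x * w) 0 := by
  have hφ' := hφ.hasFDerivAt
  set L := fderiv ℝ (fun p : ℝ × ℝ => φ p.1 p.2) (t, x)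
  have hline : ∀ v w : ℝ, HasDerivAt (fun r => φ (t + r * v) (x + r * w)) (L (v, w)) 0 := by
    intro v w
    have h1 : HasDerivAt (fun r : ℝ => t + r * v) v 0 := by
      simpa using ((hasDerivAt_id (0 : ℝ)).mul_const v).const_add t
    have h2 : HasDerivAt (fun r : ℝ => x + r * w) w 0 := by
      simpa using ((hasDerivAt_id (0 : ℝ)).mul_const w).const_add x
    exact HasFDerivAt.comp_hasDerivAt_of_eq (0 : ℝ) hφ' (h1.prodMk h2) (by simp)
  have ht : deriv (fun s => φ s x) t = L (1, 0) :=
    (HasFDerivAt.comp_hasDerivAt_of_eq t hφ'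
      ((hasDerivAt_id t).prodMk (hasDerivAt_const t x)) rfl).deriv
  have hx : deriv (φ t) x = L (0, 1) :=
    (HasFDerivAt.comp_hasDerivAt_of_eq x hφ'
      ((hasDerivAt_const x t).prodMk (hasDerivAt_id x)) rfl).deriv
  have hvw : ((v, w) : ℝ × ℝ) = v • (1, 0) + w • (0, 1) := by ext <;> simp
  convert hline v w using 1
  rw [hvw, map_add, map_smul, map_smul, ht, hx, smul_eq_mul, smul_eq_mul]
  ring

theorem derivs_eq_of_isLocalExtr_affine {q a : ℝ}
    (hφ : DifferentiableAt ℝ (fun p : ℝ × ℝ => φ p.1 p.2) (t, x))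
    (h : IsLocalExtr (fun p : ℝ × ℝ => (q * p.2 - a * p.1) - φ p.1 p.2) (t, x)) :
    deriv (fun s => φ s x) t = -a ∧ deriv (φ t) x = q := by
  have key : ∀ v w : ℝ,
      (q * w - a * v) - (deriv (fun s => φ s x) t * v + deriv (φ t) x * w) = 0 := by
    intro v w
    have hline : Continuous (fun r : ℝ => (t + r * v, x + r * w)) := by fun_prop
    have hext : IsLocalExtr
        (fun r : ℝ => (q * (x + r * w) - a * (t + r * v)) - φ (t + r * v) (x + r * w)) 0 := by
      have h' : IsLocalExtr (fun p : ℝ × ℝ => (q * p.2 - a * p.1) - φ p.1 p.2)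
          (t + 0 * v, x + 0 * w) := by
        simpa using h
      exact IsExtrFilter.comp_tendsto (g := fun r : ℝ => (t + r * v, x + r * w)) h'
        (hline.tendsto 0)
    have hd : HasDerivAt (fun r : ℝ => q * (x + r * w) - a * (t + r * v)) (q * w - a * v) 0 := by
      have h1 := (((hasDerivAt_id (0 : ℝ)).mul_const w).const_add x).const_mul q
      have h2 := (((hasDerivAt_id (0 : ℝ)).mul_const v).const_add t).const_mul a
      simp only [one_mul] at h1 h2
      exact h1.sub h2
    exact hext.hasDerivAt_eq_zero (hd.sub (hasDerivAt_comp_line hφ v w))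
  constructor
  · linarith [key 1 0]
  · linarith [key 0 1]

theorem directional_le_max_of_isLocalMin {q₁ q₂ a b : ℝ}
    (hφ : DifferentiableAt ℝ (fun p : ℝ × ℝ => φ p.1 p.2) (t, x))
    (heq : q₁ * x - a * t = q₂ * x - b * t)
    (h : IsLocalMin (fun p : ℝ × ℝ =>
      max (q₁ * p.2 - a * p.1) (q₂ * p.2 - b * p.1) - φ p.1 p.2) (t, x)) (v w : ℝ) :
    deriv (fun s => φ s x) t * v + deriv (φ t) x * w ≤ max (q₁ * w - a * v) (q₂ * w - b * v) := by
  have hline : Tendsto (fun r : ℝ => (t + r * v, x + r * w)) (𝓝 0) (𝓝 (t, x)) := by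
    have : Continuous (fun r : ℝ => (t + r * v, x + r * w)) := by fun_prop
    simpa using this.tendsto 0
  have hslope := (hasDerivAt_comp_line hφ v w).hasDerivWithinAt (s := Ioi 0)
  rw [hasDerivWithinAt_iff_tendsto_slope' (by simp)] at hslope
  refine le_of_tendsto hslope ?_
  filter_upwards [nhdsWithin_le_nhds (hline.eventually h), self_mem_nhdsWithin] with r hr hr0
  have hr0 : 0 < r := hr0
  rw [slope_def_field, sub_zero, div_le_iff₀ hr0]
  simp only [← heq, max_self] at hr
  have hmax : max (q₁ * (x + r * w) - a * (t + r * v)) (q₂ * (x + r * w) - b * (t + r * v))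
      = (q₁ * x - a * t) + max (q₁ * w - a * v) (q₂ * w - b * v) * r := by
    rw [max_mul_of_nonneg _ _ hr0.le, ← max_add_add_left]
    congr 1
    · ring
    · rw [heq]; ring
  rw [hmax] at hr
  simp only [zero_mul, add_zero]
  linarith

/-- A gradient dominated in every direction by the maximum of two linear forms lies on the segment
joining them. -/
theorem exists_segment_of_le_max {τ p q₁ q₂ a b : ℝ} (hab : b < a)
    (h : ∀ v w : ℝ, τ * v + p * w ≤ max (q₁ * w - a * v) (q₂ * w - b * v)) :
    ∃ μ, 0 ≤ μ ∧ μ ≤ 1 ∧ τ = (1 - μ) * -a + μ * -b ∧ p = (1 - μ) * q₁ + μ * q₂ := by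
  have hab' : 0 < a - b := sub_pos.2 hab
  obtain ⟨μ, hμ⟩ : ∃ μ, μ * (a - b) = τ + a := ⟨(τ + a) / (a - b), div_mul_cancel₀ _ hab'.ne'⟩
  have hτ : τ = μ * (a - b) - a := by linarith
  have h1 := h (q₂ - q₁) (-(a - b))
  have h2 := h (-(q₂ - q₁)) (a - b)
  rw [max_eq_left (by linarith)] at h1 h2
  have hp : p = q₁ + μ * (q₂ - q₁) := by
    apply mul_right_cancel₀ hab'.ne'
    subst hτ
    linarith
  have h3 := h (a - b) (q₂ - q₁)
  have h4 := h (-(a - b)) (-(q₂ - q₁))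
  have hpos : 0 < (a - b) ^ 2 + (q₂ - q₁) ^ 2 := by positivity
  rw [max_eq_right (by nlinarith)] at h3
  rw [max_eq_left (by nlinarith)] at h4
  subst hτ hp
  refine ⟨μ, ?_, ?_, by ring, by ring⟩
  · refine nonneg_of_mul_nonneg_left ?_ hpos
    nlinarith
  · refine le_of_mul_le_mul_right ?_ hpos
    nlinarith

end TestFunctions

/-- The maximum of two affine solutions of a concave Hamilton–Jacobi equation satisfies both
viscosity inequalities. -/
theorem viscosity_of_eventuallyEq_max_affine {H : ℝ → ℝ} {S : Set ℝ} (hH : ConcaveOn ℝ S H)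
    {q₁ q₂ a b : ℝ} (hq₁ : q₁ ∈ S) (hq₂ : q₂ ∈ S) (ha : H q₁ = a) (hb : H q₂ = b) (hab : b < a)
    {u φ : ℝ → ℝ → ℝ} {t x : ℝ}
    (hφ : DifferentiableAt ℝ (fun p : ℝ × ℝ => φ p.1 p.2) (t, x))
    (hu : ∀ᶠ p : ℝ × ℝ in 𝓝 (t, x),
      u p.1 p.2 = max (q₁ * p.2 - a * p.1) (q₂ * p.2 - b * p.1)) :
    (IsLocalMax (fun p : ℝ × ℝ => u p.1 p.2 - φ p.1 p.2) (t, x) →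
      deriv (fun s => φ s x) t + H (deriv (φ t) x) ≤ 0) ∧
    (IsLocalMin (fun p : ℝ × ℝ => u p.1 p.2 - φ p.1 p.2) (t, x) →
      0 ≤ deriv (fun s => φ s x) t + H (deriv (φ t) x)) := by
  have hux : u t x = max (q₁ * x - a * t) (q₂ * x - b * t) := hu.self_of_nhds
  constructor
  · intro hmax
    rcases le_total (q₂ * x - b * t) (q₁ * x - a * t) with hle | hle
    · have hext : IsLocalMax (fun p : ℝ × ℝ => (q₁ * p.2 - a * p.1) - φ p.1 p.2) (t, x) := by
        filter_upwards [hmax, hu] with p hp hup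
        rw [hux, max_eq_left hle, hup] at hp
        linarith [le_max_left (q₁ * p.2 - a * p.1) (q₂ * p.2 - b * p.1)]
      obtain ⟨h1, h2⟩ := derivs_eq_of_isLocalExtr_affine hφ (Or.inr hext)
      rw [h1, h2, ha, neg_add_cancel]
    · have hext : IsLocalMax (fun p : ℝ × ℝ => (q₂ * p.2 - b * p.1) - φ p.1 p.2) (t, x) := by
        filter_upwards [hmax, hu] with p hp hup
        rw [hux, max_eq_right hle, hup] at hp
        linarith [le_max_right (q₁ * p.2 - a * p.1) (q₂ * p.2 - b * p.1)]
      obtain ⟨h1, h2⟩ := derivs_eq_of_isLocalExtr_affine hφ (Or.inr hext)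
      rw [h1, h2, hb, neg_add_cancel]
  · intro hmin
    rcases lt_trichotomy (q₁ * x - a * t) (q₂ * x - b * t) with hlt | heq | hlt
    · have hev : ∀ᶠ p : ℝ × ℝ in 𝓝 (t, x), q₁ * p.2 - a * p.1 < q₂ * p.2 - b * p.1 :=
        ContinuousAt.eventually_lt (by fun_prop) (by fun_prop) hlt
      have hext : IsLocalMin (fun p : ℝ × ℝ => (q₂ * p.2 - b * p.1) - φ p.1 p.2) (t, x) := by
        filter_upwards [hmin, hu, hev] with p hp hup hlt'
        rwa [hux, hup, max_eq_right hlt.le, max_eq_right hlt'.le] at hp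
      obtain ⟨h1, h2⟩ := derivs_eq_of_isLocalExtr_affine hφ (Or.inl hext)
      rw [h1, h2, hb, neg_add_cancel]
    · have hext : IsLocalMin (fun p : ℝ × ℝ =>
          max (q₁ * p.2 - a * p.1) (q₂ * p.2 - b * p.1) - φ p.1 p.2) (t, x) := by
        filter_upwards [hmin, hu] with p hp hup
        rwa [hux, hup] at hp
      obtain ⟨μ, hμ0, hμ1, hτ, hp⟩ := exists_segment_of_le_max hab
        (directional_le_max_of_isLocalMin hφ heq hext)
      have hconc := hH.2 hq₁ hq₂ (sub_nonneg.2 hμ1) hμ0 (sub_add_cancel 1 μ)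
      simp only [smul_eq_mul] at hconc
      rw [hτ, hp]
      rw [ha, hb] at hconc
      linarith
    · have hev : ∀ᶠ p : ℝ × ℝ in 𝓝 (t, x), q₂ * p.2 - b * p.1 < q₁ * p.2 - a * p.1 :=
        ContinuousAt.eventually_lt (by fun_prop) (by fun_prop) hlt
      have hext : IsLocalMin (fun p : ℝ × ℝ => (q₁ * p.2 - a * p.1) - φ p.1 p.2) (t, x) := by
        filter_upwards [hmin, hu, hev] with p hp hup hlt'
        rwa [hux, hup, max_eq_left hlt.le, max_eq_left hlt'.le] at hp
      obtain ⟨h1, h2⟩ := derivs_eq_of_isLocalExtr_affine hφ (Or.inl hext)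
      rw [h1, h2, ha, neg_add_cancel]

theorem continuous_phiHat (Hl Hr : ℝ → ℝ) (Rl Rr A : ℝ) : Continuous (phiHat Hl Hr Rl Rr A) :=
  Continuous.if_le (by fun_prop) (by fun_prop) continuous_id continuous_const
    (by rintro x rfl; simp)

theorem continuous_phiCheck (Hl Hr : ℝ → ℝ) (Rl Rr A : ℝ) :
    Continuous (phiCheck Hl Hr Rl Rr A) :=
  Continuous.if_le (by fun_prop) (by fun_prop) continuous_id continuous_const
    (by rintro x rfl; simp)

/-- properties of `u(t,x) = max{φ̌_A(x) − At, φ̂_β(x) − βt}` for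
`0 ≤ β < A ≤ A_max`. -/
theorem max_of_two_solutions
    (Hl Hr : ℝ → ℝ) (Rl Rr : ℝ) (hRl : 0 < Rl) (hRr : 0 < Rr)
    (hHl : ContDiff ℝ 1 Hl) (hHlc : StrictConcaveOn ℝ (Icc 0 Rl) Hl)
    (hHl0 : Hl 0 = 0) (hHlR : Hl Rl = 0)
    (hHr : ContDiff ℝ 1 Hr) (hHrc : StrictConcaveOn ℝ (Icc 0 Rr) Hr)
    (hHr0 : Hr 0 = 0) (hHrR : Hr Rr = 0)
    (β A : ℝ) (hβ : 0 ≤ β) (hβA : β < A) (hA : A ≤ Amax Hl Hr Rl Rr)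
    (u : ℝ → ℝ → ℝ)
    (hu : ∀ t x : ℝ, u t x =
      max (phiCheck Hl Hr Rl Rr A x - A * t) (phiHat Hl Hr Rl Rr β x - β * t)) :
    Continuous (fun p : ℝ × ℝ => u p.1 p.2) ∧
    (∀ x, u 0 x = phiCheck Hl Hr Rl Rr A x) ∧
    (∀ t : ℝ, 0 ≤ t → u t 0 = -(β * t)) ∧
    (∀ t : ℝ, 0 < t → ∃ η > (0 : ℝ), ∀ s x : ℝ, |s - t| ≤ η → |x| ≤ η →
      u s x = phiHat Hl Hr Rl Rr β x - β * s) ∧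
    ViscSolOff Hl Hr u := by
  have hAl : A ≤ sSup (Hl '' Icc 0 Rl) := hA.trans (min_le_left _ _)
  have hAr : A ≤ sSup (Hr '' Icc 0 Rr) := hA.trans (min_le_right _ _)
  have hA0 : 0 ≤ A := hβ.trans hβA.le
  obtain ⟨hlA, hlA'⟩ := pm_mem_level hHl.continuous
    (exists_level_of_le_sSup hHl.continuous hRl hHl0 hA0 hAl)
  obtain ⟨hlβ, hlβ'⟩ := pp_mem_level hHl.continuous
    (exists_level_of_le_sSup hHl.continuous hRl hHl0 hβ (hβA.le.trans hAl))
  obtain ⟨hrA, hrA'⟩ := pp_mem_level hHr.continuous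
    (exists_level_of_le_sSup hHr.continuous hRr hHr0 hA0 hAr)
  obtain ⟨hrβ, hrβ'⟩ := pm_mem_level hHr.continuous
    (exists_level_of_le_sSup hHr.continuous hRr hHr0 hβ (hβA.le.trans hAr))
  have hl : pm Hl Rl A ≤ pp Hl Rl β :=
    le_pp_of_le_level hHl.continuous hHlR hβ hlA (hβA.le.trans hlA'.ge)
  have hr : pm Hr Rr β ≤ pp Hr Rr A :=
    pm_le_of_le_level hHr.continuous hHr0 hβ hrA (hβA.le.trans hrA'.ge)
  have hcHat := continuous_phiHat Hl Hr Rl Rr β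
  have hcCheck := continuous_phiCheck Hl Hr Rl Rr A
  refine ⟨?_, ?_, ?_, ?_, ?_⟩
  · simp only [hu]
    fun_prop
  · intro x
    rw [hu, mul_zero, mul_zero, sub_zero, sub_zero]
    apply max_eq_left
    unfold phiHat phiCheck
    split_ifs with hx
    · exact mul_le_mul_of_nonpos_right hl hx
    · exact mul_le_mul_of_nonneg_right hr (not_le.1 hx).le
  · intro t ht
    have : β * t ≤ A * t := mul_le_mul_of_nonneg_right hβA.le ht
    rw [hu]
    simpa [phiHat, phiCheck] using this
  · intro t ht
    have hlt : phiCheck Hl Hr Rl Rr A (t, (0 : ℝ)).2 - A * (t, (0 : ℝ)).1 <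
        phiHat Hl Hr Rl Rr β (t, (0 : ℝ)).2 - β * (t, (0 : ℝ)).1 := by
      have : β * t < A * t := mul_lt_mul_of_pos_right hβA ht
      simpa [phiHat, phiCheck] using this
    have hev : ∀ᶠ p : ℝ × ℝ in 𝓝 (t, 0),
        phiCheck Hl Hr Rl Rr A p.2 - A * p.1 < phiHat Hl Hr Rl Rr β p.2 - β * p.1 :=
      ContinuousAt.eventually_lt (by fun_prop) (by fun_prop) hlt
    obtain ⟨η, hη, hball⟩ := Metric.nhds_basis_closedBall.eventually_iff.1 hev
    refine ⟨η, hη, fun s x hs hx => ?_⟩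
    have hmem : (s, x) ∈ Metric.closedBall (t, (0 : ℝ)) η := by
      rw [Metric.mem_closedBall, Prod.dist_eq, Real.dist_eq, Real.dist_eq, sub_zero]
      exact max_le hs hx
    rw [hu]
    exact max_eq_right (hball hmem).le
  · intro φ hφ t x ht hx
    have hdom : domHJ ∈ 𝓝 (t, x) := prod_mem_nhds (Ici_mem_nhds ht) univ_mem
    have hφ' := (hφ.differentiable one_ne_zero).differentiableAt (x := (t, x))
    suffices h : (IsLocalMax (fun p : ℝ × ℝ => u p.1 p.2 - φ p.1 p.2) (t, x) →
          deriv (fun s => φ s x) t + Hx Hl Hr x (deriv (φ t) x) ≤ 0) ∧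
        (IsLocalMin (fun p : ℝ × ℝ => u p.1 p.2 - φ p.1 p.2) (t, x) →
          0 ≤ deriv (fun s => φ s x) t + Hx Hl Hr x (deriv (φ t) x)) from
      ⟨fun hm => h.1 (hm.isLocalMax hdom), fun hm => h.2 (hm.isLocalMin hdom)⟩
    rcases lt_or_gt_of_ne hx with hx | hx
    · simp only [Hx, if_pos hx]
      refine viscosity_of_eventuallyEq_max_affine hHlc.concaveOn hlA hlβ hlA' hlβ' hβA hφ' ?_
      filter_upwards [continuous_snd.tendsto (t, x) |>.eventually (gt_mem_nhds hx)] with p hp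
      rw [hu, phiCheck, phiHat, if_pos hp.le, if_pos hp.le]
    · simp only [Hx, if_neg hx.not_gt]
      refine viscosity_of_eventuallyEq_max_affine hHrc.concaveOn hrA hrβ hrA' hrβ' hβA hφ' ?_
      filter_upwards [continuous_snd.tendsto (t, x) |>.eventually (lt_mem_nhds hx)] with p hp
      rw [hu, phiCheck, phiHat, if_neg hp.not_ge, if_neg hp.not_ge]
end
end

section
/- Let A ∈ ℝ and q ∈ [0,R] with H(q) ≤ A. Then sup_{y ∈ [0,R]} (−H'(q) y + min{H(y), A}) = H(q) − q H'(q). -/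
open Set

noncomputable section

/-- A concave function lies below its tangent line at a point of differentiability. -/
theorem ConcaveOn.le_tangent_of_hasDerivAt {S : Set ℝ} {f : ℝ → ℝ} {f' x y : ℝ}
    (hf : ConcaveOn ℝ S f) (hx : x ∈ S) (hy : y ∈ S) (hd : HasDerivAt f f' x) :
    f y ≤ f x + f' * (y - x) := by
  rcases lt_trichotomy x y with h | rfl | h
  · have hs := hf.slope_le_of_hasDerivAt hx hy h hd
    rw [slope_def_field, div_le_iff₀ (sub_pos.2 h)] at hs
    linarith
  · simp
  · have hs := hf.le_slope_of_hasDerivAt hy hx h hd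
    rw [slope_def_field, le_div_iff₀ (sub_pos.2 h)] at hs
    linarith

/-- for `H` C¹ and concave on `[0,R]`, `q ∈ [0,R]` with `H(q) ≤ A`,
`sup_{y ∈ [0,R]} (−H'(q) y + min{H(y), A}) = H(q) − q H'(q)`. -/
theorem sup_formula_legendre
    (R : ℝ) (hR : 0 < R) (H : ℝ → ℝ) (hH : ContDiff ℝ 1 H)
    (hconc : ConcaveOn ℝ (Icc 0 R) H)
    (A : ℝ) (q : ℝ) (hq : q ∈ Icc 0 R) (hA : H q ≤ A) :
    sSup ((fun y => -(deriv H q * y) + min (H y) A) '' Icc 0 R)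
      = H q - q * deriv H q := by
  have hd : HasDerivAt H (deriv H q) q := (hH.differentiable one_ne_zero q).hasDerivAt
  refine IsGreatest.csSup_eq ⟨⟨q, hq, ?_⟩, ?_⟩
  · simp only [min_eq_left hA]
    ring
  · rintro _ ⟨y, hy, rfl⟩
    have htangent := hconc.le_tangent_of_hasDerivAt hq hy hd
    have hmin := min_le_left (H y) A
    dsimp only
    linarith
end
end
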